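/- arXiv:1201.4839 — 5 statements merged into one kernel-verified Lean document; each statement's English description precedes it below -/
import Mathlib

section
/- Let ν be a probability measure on a measurable space Ω and let ω ↦ U_ω be a measurable family of unitary n×n complex matrices. If the operator norm of the averaged matrix Ũ = ∫ U_ω dν(ω) equals 1, then there exist unit vectors φ, ψ ∈ ℂⁿ such that U_ω ψ = φ for ν-almost every ω. -/
open MeasureTheory Matrix

/-- The operator norm of a matrix acting on Euclidean space (ℓ² norm). -/
noncomputable def opNorm {m : Type*} [Fintype m] [DecidableEq m]
    (A : Matrix m m ℂ) : ℝ :=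
  ‖Matrix.toEuclideanCLM (𝕜 := ℂ) A‖

/-- A continuous linear map on a nontrivial finite-dimensional space attains its operator norm
at a unit vector. -/
theorem ContinuousLinearMap.exists_norm_eq_one_norm_apply_eq_opNorm {E F : Type*}
    [NormedAddCommGroup E] [NormedSpace ℂ E] [FiniteDimensional ℂ E] [Nontrivial E]
    [NormedAddCommGroup F] [NormedSpace ℂ F] (A : E →L[ℂ] F) :
    ∃ x : E, ‖x‖ = 1 ∧ ‖A x‖ = ‖A‖ := by
  have : ProperSpace E := FiniteDimensional.proper ℂ E
  obtain ⟨y, hy⟩ := exists_ne (0 : E)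
  have hne : (Metric.sphere (0 : E) 1).Nonempty :=
    ⟨((‖y‖⁻¹ : ℝ) : ℂ) • y, by simp [norm_smul, hy]⟩
  obtain ⟨x, hx, hmax⟩ := (isCompact_sphere (0 : E) 1).exists_isMaxOn hne
    (A.continuous.norm.continuousOn)
  have hx1 : ‖x‖ = 1 := by simpa using hx
  refine ⟨x, hx1, le_antisymm (by simpa [hx1] using A.le_opNorm x) ?_⟩
  refine A.opNorm_le_bound (norm_nonneg _) fun z => ?_
  rcases eq_or_ne z 0 with rfl | hz
  · simp
  have hz' : ‖z‖ ≠ 0 := norm_ne_zero_iff.2 hz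
  have h := hmax (show ((‖z‖⁻¹ : ℝ) : ℂ) • z ∈ Metric.sphere (0 : E) 1 by
    simp [norm_smul, hz])
  have h' : ‖z‖⁻¹ * ‖A z‖ ≤ ‖A x‖ := by simpa [norm_smul] using h
  rwa [inv_mul_le_iff₀ (by positivity), mul_comm] at h'

/-- A unitary matrix acts isometrically on Euclidean space. -/
theorem Matrix.norm_toEuclideanCLM_apply_of_mem_unitaryGroup {m : Type*} [Fintype m]
    [DecidableEq m] {V : Matrix m m ℂ} (hV : V ∈ Matrix.unitaryGroup m ℂ)
    (x : EuclideanSpace ℂ m) : ‖Matrix.toEuclideanCLM (𝕜 := ℂ) V x‖ = ‖x‖ := by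
  have h : Matrix.toEuclideanCLM (𝕜 := ℂ) V ∈
      unitary (EuclideanSpace ℂ m →L[ℂ] EuclideanSpace ℂ m) :=
    Unitary.map_mem _ hV
  exact ContinuousLinearMap.norm_map_of_mem_unitary h x

/-- If the operator norm of the average `Ũ = ∫ U_ω dν(ω)` of a measurable family of
unitary matrices equals `1` (with `ν` a probability measure), then there exist unit vectors
`φ, ψ` with `U_ω ψ = φ` for ν-almost every `ω`. -/
theorem avg_unitary_opNorm_eq_one {Ω : Type*} [MeasurableSpace Ω]
    (ν : Measure Ω) [IsProbabilityMeasure ν]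
    {n : ℕ} (hn : 1 ≤ n) (U : Ω → Matrix (Fin n) (Fin n) ℂ)
    (hmeas : ∀ i j, Measurable fun ω => U ω i j)
    (hunit : ∀ ω, U ω ∈ Matrix.unitaryGroup (Fin n) ℂ)
    (hnorm : opNorm (Matrix.of fun i j => ∫ ω, U ω i j ∂ν) = 1) :
    ∃ (φ ψ : EuclideanSpace ℂ (Fin n)), ‖φ‖ = 1 ∧ ‖ψ‖ = 1 ∧
      ∀ᵐ ω ∂ν, Matrix.toEuclideanCLM (𝕜 := ℂ) (U ω) ψ = φ := by
  have : Nonempty (Fin n) := ⟨⟨0, hn⟩⟩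
  obtain ⟨ψ, hψ, hA⟩ := (Matrix.toEuclideanCLM (𝕜 := ℂ)
    (Matrix.of fun i j => ∫ ω, U ω i j ∂ν)).exists_norm_eq_one_norm_apply_eq_opNorm
  replace hA := hA.trans hnorm
  set f : Ω → EuclideanSpace ℂ (Fin n) := fun ω => Matrix.toEuclideanCLM (𝕜 := ℂ) (U ω) ψ
    with hf
  have hcoord : ∀ ω i, f ω i = ∑ j, U ω i j * ψ j := fun ω i => by
    simp [hf, Matrix.mulVec, dotProduct]
  have hf_norm : ∀ ω, ‖f ω‖ = 1 := fun ω =>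
    (Matrix.norm_toEuclideanCLM_apply_of_mem_unitaryGroup (hunit ω) ψ).trans hψ
  have hf_meas : Measurable f := by
    refine (WithLp.measurable_toLp 2 (Fin n → ℂ)).comp
      (measurable_pi_lambda (fun ω i => f ω i) fun i => ?_)
    simp only [hcoord]
    fun_prop
  have hf_int : Integrable f ν :=
    Integrable.of_bound hf_meas.aestronglyMeasurable 1 (.of_forall fun ω => (hf_norm ω).le)
  have hU_int : ∀ i j, Integrable (fun ω => U ω i j) ν := fun i j =>
    Integrable.of_bound (hmeas i j).aestronglyMeasurable 1
      (.of_forall fun ω => entry_norm_bound_of_unitary (hunit ω) i j)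
  have hf_integral : ∫ ω, f ω ∂ν = Matrix.toEuclideanCLM (𝕜 := ℂ)
      (Matrix.of fun i j => ∫ ω, U ω i j ∂ν) ψ := by
    ext i
    have h :=
      (EuclideanSpace.proj i : EuclideanSpace ℂ (Fin n) →L[ℂ] ℂ).integral_comp_comm hf_int
    simp only [PiLp.proj_apply] at h
    rw [← h]
    simp only [hcoord]
    rw [integral_finsetSum _ fun j _ => (hU_int i j).mul_const _]
    simp [Matrix.mulVec, dotProduct, integral_mul_const]
  refine ⟨∫ ω, f ω ∂ν, ψ, by rw [hf_integral, hA], hψ, ?_⟩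
  rcases ae_eq_const_or_norm_integral_lt_of_norm_le_const
    (Filter.Eventually.of_forall fun ω => (hf_norm ω).le : ∀ᵐ ω ∂ν, ‖f ω‖ ≤ 1) with h | h
  · filter_upwards [h] with ω hω
    simpa [average_eq_integral] using hω
  · rw [hf_integral, hA] at h
    simp at h
end

section
/- Let ν be a probability measure on a measurable space Ω and let ω ↦ U_ω be a measurable family of unitary n×n complex matrices. Assume that the only n×n complex matrices B satisfying B·(U_ω U_{ω'}*) = (U_ω U_{ω'}*)·B for (ν⊗ν)-almost every pair (ω, ω') are the scalar multiples of the identity. Then for every nonzero n×n complex matrix A with tr(A) = 0, the averaged random-unitary channel satisfies the strict inequality ‖∫ U_ω* A U_ω dν(ω)‖_F < ‖A‖_F. -/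
open MeasureTheory Matrix

/-- The Frobenius (Hilbert–Schmidt) norm `‖A‖_F = √(tr(A*A))` of a complex matrix. -/
noncomputable def frobNorm {m : Type*} [Fintype m] (A : Matrix m m ℂ) : ℝ :=
  Real.sqrt (Matrix.trace (Aᴴ * A)).re

/-- The entries of a square matrix, as a vector of a Euclidean space. -/
noncomputable def entryVec {m : Type*} (A : Matrix m m ℂ) : EuclideanSpace ℂ (m × m) :=
  WithLp.toLp 2 fun p => A p.1 p.2

theorem entryVec_injective {m : Type*} : Function.Injective (entryVec (m := m)) := by
  intro A B h
  ext i j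
  exact congrArg (fun v : EuclideanSpace ℂ (m × m) => v (i, j)) h

theorem frobNorm_eq_norm_entryVec {m : Type*} [Fintype m] (A : Matrix m m ℂ) :
    frobNorm A = ‖entryVec A‖ := by
  rw [frobNorm, EuclideanSpace.norm_eq, Fintype.sum_prod_type, Finset.sum_comm]
  congr 1
  simp only [trace, diag_apply, mul_apply, conjTranspose_apply, Complex.re_sum, entryVec]
  refine Finset.sum_congr rfl fun i _ => Finset.sum_congr rfl fun j _ => ?_
  rw [Complex.sq_norm, Complex.normSq_apply]
  simp

theorem frobNorm_conj_unitary {m : Type*} [Fintype m] [DecidableEq m] {V : Matrix m m ℂ}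
    (hV : V ∈ Matrix.unitaryGroup m ℂ) (A : Matrix m m ℂ) :
    frobNorm (Vᴴ * A * V) = frobNorm A := by
  have h : V * Vᴴ = 1 := Matrix.mem_unitaryGroup_iff.mp hV
  have e : (Vᴴ * A * V)ᴴ * (Vᴴ * A * V) = Vᴴ * (Aᴴ * A * V) := by
    calc (Vᴴ * A * V)ᴴ * (Vᴴ * A * V) = Vᴴ * (Aᴴ * (V * Vᴴ) * A * V) := by
          simp only [conjTranspose_mul, conjTranspose_conjTranspose, Matrix.mul_assoc]
      _ = Vᴴ * (Aᴴ * A * V) := by rw [h, Matrix.mul_one]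
  rw [frobNorm, frobNorm, e, trace_mul_comm, Matrix.mul_assoc, h, Matrix.mul_one]

theorem commute_mul_conjTranspose_of_conj_eq {m : Type*} [Fintype m] [DecidableEq m]
    {V W A : Matrix m m ℂ} (hV : V ∈ Matrix.unitaryGroup m ℂ)
    (hW : W ∈ Matrix.unitaryGroup m ℂ) (h : Vᴴ * A * V = Wᴴ * A * W) :
    A * (V * Wᴴ) = (V * Wᴴ) * A := by
  have hV' : V * Vᴴ = 1 := Matrix.mem_unitaryGroup_iff.mp hV
  have hW' : W * Wᴴ = 1 := Matrix.mem_unitaryGroup_iff.mp hW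
  calc A * (V * Wᴴ) = (V * Vᴴ) * A * (V * Wᴴ) := by rw [hV', Matrix.one_mul]
    _ = V * (Vᴴ * A * V) * Wᴴ := by simp only [Matrix.mul_assoc]
    _ = V * Wᴴ * A * (W * Wᴴ) := by rw [h]; simp only [Matrix.mul_assoc]
    _ = (V * Wᴴ) * A := by rw [hW', Matrix.mul_one]

/-- If the only matrices commuting with `U_ω U_{ω'}*` for (ν⊗ν)-a.e. `(ω, ω')` are the
scalar multiples of the identity, then the averaged random-unitary channel is strictly
contractive in Frobenius norm on nonzero traceless matrices. -/
theorem frobNorm_avg_conj_lt_of_irreducible {Ω : Type*} [MeasurableSpace Ω]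
    (ν : Measure Ω) [IsProbabilityMeasure ν]
    {n : ℕ} (hn : 1 ≤ n) (U : Ω → Matrix (Fin n) (Fin n) ℂ)
    (hmeas : ∀ i j, Measurable fun ω => U ω i j)
    (hunit : ∀ ω, U ω ∈ Matrix.unitaryGroup (Fin n) ℂ)
    (hirr : ∀ B : Matrix (Fin n) (Fin n) ℂ,
      (∀ᵐ p ∂(ν.prod ν), B * (U p.1 * (U p.2)ᴴ) = (U p.1 * (U p.2)ᴴ) * B) →
      ∃ c : ℂ, B = c • (1 : Matrix (Fin n) (Fin n) ℂ))
    (A : Matrix (Fin n) (Fin n) ℂ) (hA : A ≠ 0) (htr : Matrix.trace A = 0) :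
    frobNorm (Matrix.of fun i j => ∫ ω, ((U ω)ᴴ * A * U ω) i j ∂ν) < frobNorm A := by
  have hX : ∀ p : Fin n × Fin n, Measurable fun ω => entryVec ((U ω)ᴴ * A * U ω) p := by
    intro p
    simp only [entryVec, mul_apply, conjTranspose_apply]
    fun_prop
  have hnorm : ∀ ω, ‖entryVec ((U ω)ᴴ * A * U ω)‖ = frobNorm A := fun ω => by
    rw [← frobNorm_eq_norm_entryVec, frobNorm_conj_unitary (hunit ω)]
  have hint : ∀ p : Fin n × Fin n,
      Integrable (fun ω => entryVec ((U ω)ᴴ * A * U ω) p) ν := fun p =>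
    Integrable.of_bound (hX p).aestronglyMeasurable (frobNorm A)
      (.of_forall fun ω => (PiLp.norm_apply_le _ p).trans (hnorm ω).le)
  have havg : entryVec (Matrix.of fun i j => ∫ ω, ((U ω)ᴴ * A * U ω) i j ∂ν)
      = ∫ ω, entryVec ((U ω)ᴴ * A * U ω) ∂ν := by
    ext p
    rw [eval_integral_piLp hint]
    rfl
  rw [frobNorm_eq_norm_entryVec, havg]
  rcases ae_eq_const_or_norm_integral_lt_of_norm_le_const
    (.of_forall fun ω => (hnorm ω).le : ∀ᵐ ω ∂ν, ‖entryVec ((U ω)ᴴ * A * U ω)‖ ≤ frobNorm A)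
    with hconst | hlt
  · exfalso
    obtain ⟨c, rfl⟩ := hirr A (by
      filter_upwards [Measure.quasiMeasurePreserving_fst.ae hconst,
        Measure.quasiMeasurePreserving_snd.ae hconst] with p h₁ h₂
      exact commute_mul_conjTranspose_of_conj_eq (hunit _) (hunit _)
        (entryVec_injective (h₁.trans h₂.symm)))
    have hc : c = 0 := by
      simpa [trace_smul, Nat.one_le_iff_ne_zero.mp hn] using htr
    exact hA (by rw [hc, zero_smul])
  · simpa using hlt
end

section
/- Let ν be a probability measure on a measurable space Ω and let ω ↦ U_ω be a measurable family of unitary n×n complex matrices. If an n×n complex matrix A satisfies the equality ‖∫ U_ω* A U_ω dν(ω)‖_F = ‖A‖_F, then A commutes with U_ω U_{ω'}* for (ν⊗ν)-almost every pair (ω, ω'). -/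
open MeasureTheory Matrix

lemma norm_entryVec {m : Type*} [Fintype m] (A : Matrix m m ℂ) :
    ‖entryVec A‖ = frobNorm A := by
  rw [EuclideanSpace.norm_eq, frobNorm]
  congr 1
  simp only [entryVec, Matrix.trace, Matrix.diag, Matrix.mul_apply, Matrix.conjTranspose_apply,
    Complex.re_sum, Fintype.sum_prod_type]
  rw [Finset.sum_comm]
  refine Finset.sum_congr rfl fun i _ => Finset.sum_congr rfl fun j _ => ?_
  rw [Complex.sq_norm, Complex.normSq_apply]
  simp

lemma frobNorm_conj {m : Type*} [Fintype m] [DecidableEq m] {U : Matrix m m ℂ}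
    (hU : U ∈ Matrix.unitaryGroup m ℂ) (A : Matrix m m ℂ) :
    frobNorm (Uᴴ * A * U) = frobNorm A := by
  have hU' : U * Uᴴ = 1 := Matrix.mem_unitaryGroup_iff.1 hU
  have h : (Uᴴ * A * U)ᴴ * (Uᴴ * A * U) = Uᴴ * (Aᴴ * A * U) := by
    simp only [Matrix.conjTranspose_mul, Matrix.conjTranspose_conjTranspose, Matrix.mul_assoc]
    rw [← Matrix.mul_assoc U Uᴴ, hU', Matrix.one_mul]
  rw [frobNorm, frobNorm, h, Matrix.trace_mul_comm, Matrix.mul_assoc, hU', Matrix.mul_one]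

lemma commute_of_conj_eq {m : Type*} [Fintype m] [DecidableEq m] {U V A : Matrix m m ℂ}
    (hU : U ∈ Matrix.unitaryGroup m ℂ) (hV : V ∈ Matrix.unitaryGroup m ℂ)
    (h : Uᴴ * A * U = Vᴴ * A * V) :
    A * (U * Vᴴ) = (U * Vᴴ) * A := by
  have hU' : U * Uᴴ = 1 := Matrix.mem_unitaryGroup_iff.1 hU
  have hV' : V * Vᴴ = 1 := Matrix.mem_unitaryGroup_iff.1 hV
  calc A * (U * Vᴴ) = (U * Uᴴ) * (A * (U * Vᴴ)) := by rw [hU', Matrix.one_mul]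
    _ = U * (Uᴴ * A * U) * Vᴴ := by simp only [Matrix.mul_assoc]
    _ = U * (Vᴴ * A * V) * Vᴴ := by rw [h]
    _ = U * Vᴴ * A * (V * Vᴴ) := by simp only [Matrix.mul_assoc]
    _ = (U * Vᴴ) * A := by rw [hV', Matrix.mul_one]

/-- If the averaged random-unitary channel preserves the Frobenius norm of `A`, then `A`
commutes with `U_ω U_{ω'}*` for (ν⊗ν)-almost every pair `(ω, ω')`. -/
theorem commutes_ae_of_frobNorm_avg_conj_eq {Ω : Type*} [MeasurableSpace Ω]
    (ν : Measure Ω) [IsProbabilityMeasure ν]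
    {n : ℕ} (hn : 1 ≤ n) (U : Ω → Matrix (Fin n) (Fin n) ℂ)
    (hmeas : ∀ i j, Measurable fun ω => U ω i j)
    (hunit : ∀ ω, U ω ∈ Matrix.unitaryGroup (Fin n) ℂ)
    (A : Matrix (Fin n) (Fin n) ℂ)
    (heq : frobNorm (Matrix.of fun i j => ∫ ω, ((U ω)ᴴ * A * U ω) i j ∂ν) = frobNorm A) :
    ∀ᵐ p ∂(ν.prod ν),
      A * (U p.1 * (U p.2)ᴴ) = (U p.1 * (U p.2)ᴴ) * A := by
  set X : Ω → Matrix (Fin n) (Fin n) ℂ := fun ω => (U ω)ᴴ * A * U ω with hX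
  have hXm : ∀ i j, Measurable fun ω => X ω i j := by
    intro i j
    simp only [hX, Matrix.mul_apply, Matrix.conjTranspose_apply]
    have hstar : ∀ i j, Measurable fun ω => star (U ω i j) := fun i j =>
      continuous_star.measurable.comp (hmeas i j)
    fun_prop
  have hXnorm : ∀ ω, ‖entryVec (X ω)‖ = frobNorm A := fun ω => by
    rw [norm_entryVec, frobNorm_conj (hunit ω)]
  have hvm : Measurable fun ω => entryVec (X ω) :=
    (WithLp.measurable_toLp 2 _).comp (measurable_pi_lambda _ fun p => hXm p.1 p.2)
  have hint : Integrable (fun ω => entryVec (X ω)) ν :=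
    Integrable.of_bound hvm.aestronglyMeasurable (frobNorm A)
      (Filter.Eventually.of_forall fun ω => (hXnorm ω).le)
  have havg : ∫ ω, entryVec (X ω) ∂ν = entryVec (Matrix.of fun i j => ∫ ω, X ω i j ∂ν) := by
    ext p
    exact ((EuclideanSpace.proj (𝕜 := ℂ) p).integral_comp_comm hint).symm
  have hconst : ∀ᵐ ω ∂ν, entryVec (X ω) = ⨍ ω, entryVec (X ω) ∂ν := by
    refine (ae_eq_const_or_norm_integral_lt_of_norm_le_const
      (Filter.Eventually.of_forall fun ω => (hXnorm ω).le)).resolve_right ?_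
    rw [havg, norm_entryVec, heq]
    simp
  filter_upwards [Measure.quasiMeasurePreserving_fst.ae hconst,
    Measure.quasiMeasurePreserving_snd.ae hconst] with p h₁ h₂
  refine commute_of_conj_eq (hunit p.1) (hunit p.2) ?_
  ext i j
  exact congrArg (fun v : EuclideanSpace ℂ (Fin n × Fin n) => v (i, j)) (h₁.trans h₂.symm)
end

section
/- Let U and V be Hermitian unitary n×n complex matrices that have no common eigenvector. Then for every w ∈ (0,1), the convex combination satisfies the strict operator-norm bound ‖w·U + (1−w)·V‖_op < 1. -/
open Matrix

/-- In finite dimension the operator norm is attained on the unit sphere, so a strict bound there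
is a strict bound on the operator norm. -/
theorem ContinuousLinearMap.opNorm_lt_of_forall_norm_eq_one {𝕜 E F : Type*} [RCLike 𝕜]
    [NormedAddCommGroup E] [NormedSpace 𝕜 E] [FiniteDimensional 𝕜 E]
    [NormedAddCommGroup F] [NormedSpace 𝕜 F] (T : E →L[𝕜] F) {c : ℝ} (hc : 0 < c)
    (h : ∀ x, ‖x‖ = 1 → ‖T x‖ < c) : ‖T‖ < c := by
  have : ProperSpace E := FiniteDimensional.proper 𝕜 E
  rcases (Metric.sphere (0 : E) 1).eq_empty_or_nonempty with hs | hs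
  · refine (opNorm_le_of_unit_norm le_rfl fun x hx => ?_).trans_lt hc
    exact absurd (mem_sphere_zero_iff_norm.2 hx) (by simp [hs])
  · obtain ⟨x, hx, hmax⟩ := (isCompact_sphere (0 : E) 1).exists_isMaxOn hs
      (f := fun x => ‖T x‖) (by fun_prop)
    exact (opNorm_le_of_unit_norm (norm_nonneg (T x)) fun y hy =>
      hmax (mem_sphere_zero_iff_norm.2 hy)).trans_lt (h x (mem_sphere_zero_iff_norm.1 hx))

theorem Matrix.norm_toEuclideanCLM_of_mem_unitaryGroup {m : Type*} [Fintype m] [DecidableEq m]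
    {U : Matrix m m ℂ} (hU : U ∈ Matrix.unitaryGroup m ℂ) (x : EuclideanSpace ℂ m) :
    ‖Matrix.toEuclideanCLM (𝕜 := ℂ) U x‖ = ‖x‖ :=
  ContinuousLinearMap.norm_map_of_mem_unitary (Unitary.map_mem _ hU) x

/-- Two involutive linear maps which agree at a nonzero vector have a common eigenvector. -/
theorem exists_common_eigenvector_of_involutive {R M : Type*} [Ring R] [AddCommGroup M]
    [Module R M] {f g : M →ₗ[R] M} (hf : Function.Involutive f) (hg : Function.Involutive g)
    {x : M} (hx : x ≠ 0) (h : f x = g x) :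
    ∃ y ≠ 0, (∃ a : R, f y = a • y) ∧ ∃ b : R, g y = b • y := by
  by_cases hs : x + f x = 0
  · have hfx : f x = -x := (neg_eq_of_add_eq_zero_right hs).symm
    exact ⟨x, hx, ⟨-1, by simp [hfx]⟩, ⟨-1, by simp [← h, hfx]⟩⟩
  · refine ⟨x + f x, hs, ⟨1, ?_⟩, ⟨1, ?_⟩⟩
    · rw [map_add, hf x, one_smul, add_comm]
    · rw [h, map_add, hg x, one_smul, add_comm]

theorem Matrix.IsHermitian.involutive_mulVecLin {m : Type*} [Fintype m] [DecidableEq m]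
    {U : Matrix m m ℂ} (hU : U.IsHermitian) (hU' : U ∈ Matrix.unitaryGroup m ℂ) :
    Function.Involutive U.mulVecLin := fun x => by
  have h : U * U = 1 := by
    simpa only [star_eq_conjTranspose, hU.eq] using Matrix.mem_unitaryGroup_iff.1 hU'
  simp [h]

/-- A strict convex combination of two Hermitian unitary matrices with no common
eigenvector has operator norm strictly less than `1`. -/
theorem opNorm_convex_combination_lt_one {n : ℕ} (hn : 1 ≤ n)
    (U V : Matrix (Fin n) (Fin n) ℂ)
    (hUherm : U.IsHermitian) (hVherm : V.IsHermitian)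
    (hUunit : U ∈ Matrix.unitaryGroup (Fin n) ℂ)
    (hVunit : V ∈ Matrix.unitaryGroup (Fin n) ℂ)
    (hnoeig : ¬ ∃ ψ : Fin n → ℂ, ψ ≠ 0 ∧ (∃ a : ℂ, U.mulVec ψ = a • ψ) ∧
      (∃ b : ℂ, V.mulVec ψ = b • ψ))
    {w : ℝ} (hw : w ∈ Set.Ioo (0 : ℝ) 1) :
    opNorm ((w : ℂ) • U + ((1 - w : ℝ) : ℂ) • V) < 1 := by
  refine ContinuousLinearMap.opNorm_lt_of_forall_norm_eq_one _ one_pos fun x hx => ?_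
  have hne : Matrix.toEuclideanCLM (𝕜 := ℂ) U x ≠ Matrix.toEuclideanCLM (𝕜 := ℂ) V x := by
    intro h
    refine hnoeig (exists_common_eigenvector_of_involutive
      (hUherm.involutive_mulVecLin hUunit) (hVherm.involutive_mulVecLin hVunit)
      (x := x.ofLp) ?_ (congrArg WithLp.ofLp h))
    intro h0
    have : x = 0 := by ext i; simp [h0]
    simp [this] at hx
  have := norm_combo_lt_of_ne
    ((Matrix.norm_toEuclideanCLM_of_mem_unitaryGroup hUunit x).trans hx).le
    ((Matrix.norm_toEuclideanCLM_of_mem_unitaryGroup hVunit x).trans hx).le hne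
    hw.1 (sub_pos.2 hw.2) (add_sub_cancel w 1)
  rw [map_add, map_smul, map_smul]
  simpa only [_root_.add_apply, _root_.smul_apply, Complex.coe_smul] using this
end

section
/- Let r_0 ∈ ℝ and σ > 0, and let ν be the probability measure on ℝ with density r ↦ (1/N)·e^{−(r−r_0)²/σ²} supported on the interval [r_0−π, r_0+π], where N = ∫_{r_0−π}^{r_0+π} e^{−(r−r_0)²/σ²} dr. Then the averaged coin matrix Ũ = ∫ U_r dν(r) satisfies ‖Ũ‖_op < 1. -/
open MeasureTheory Matrix

/-- The coin matrix `U_r = [[cos r, sin r],[sin r, −cos r]]`. -/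
noncomputable def coinMat (r : ℝ) : Matrix (Fin 2) (Fin 2) ℂ :=
  !![(Real.cos r : ℂ), (Real.sin r : ℂ); (Real.sin r : ℂ), -(Real.cos r : ℂ)]

/-- A mean of points of the unit circle, with respect to a positive continuous probability density
on an interval of length at least `π`, lies in the open unit disc. -/
theorem sq_integral_cos_add_sq_integral_sin_lt_one {u v : ℝ} (huv : u + Real.pi ≤ v) {w : ℝ → ℝ}
    (hw : Continuous w) (hpos : ∀ r, 0 < w r) (hone : ∫ r in u..v, w r = 1) :
    (∫ r in u..v, w r * Real.cos r) ^ 2 + (∫ r in u..v, w r * Real.sin r) ^ 2 < 1 := by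
  set a := ∫ r in u..v, w r * Real.cos r with ha
  set b := ∫ r in u..v, w r * Real.sin r with hb
  have hcos : Continuous fun r => w r * Real.cos r := by fun_prop
  have hsin : Continuous fun r => w r * Real.sin r := by fun_prop
  have hpi := Real.pi_pos
  have key : 0 < ∫ r in u..v, w r * ((Real.cos r - a) ^ 2 + (Real.sin r - b) ^ 2) := by
    refine intervalIntegral.integral_pos (by linarith) (by fun_prop)
      (fun r _ => mul_nonneg (hpos r).le (by positivity)) ?_
    by_contra! h
    have hzero : ∀ r ∈ Set.Icc u v, (Real.cos r - a) ^ 2 + (Real.sin r - b) ^ 2 ≤ 0 :=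
      fun r hr => nonpos_of_mul_nonpos_right (h r hr) (hpos r)
    have h₁ := hzero u ⟨le_rfl, by linarith⟩
    have h₂ := hzero (u + Real.pi) ⟨by linarith, huv⟩
    rw [Real.cos_add_pi, Real.sin_add_pi] at h₂
    nlinarith [Real.sin_sq_add_cos_sq u, sq_nonneg a, sq_nonneg b]
  have hexpand : ∀ r, w r * ((Real.cos r - a) ^ 2 + (Real.sin r - b) ^ 2) =
      (1 + a ^ 2 + b ^ 2) * w r - 2 * a * (w r * Real.cos r) - 2 * b * (w r * Real.sin r) :=
    fun r => by linear_combination w r * Real.sin_sq_add_cos_sq r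
  simp_rw [hexpand] at key
  rw [intervalIntegral.integral_sub (Continuous.intervalIntegrable (by fun_prop) _ _)
      (Continuous.intervalIntegrable (by fun_prop) _ _),
    intervalIntegral.integral_sub (Continuous.intervalIntegrable (by fun_prop) _ _)
      (Continuous.intervalIntegrable (by fun_prop) _ _)] at key
  simp only [intervalIntegral.integral_const_mul] at key
  rw [hone, ← ha, ← hb] at key
  nlinarith

/-- The real reflection-type matrix `[[a, b], [b, -a]]` scales lengths by `√(a² + b²)`. -/
theorem opNorm_reflection_le (a b : ℝ) :
    opNorm !![(a : ℂ), (b : ℂ); (b : ℂ), -(a : ℂ)] ≤ Real.sqrt (a ^ 2 + b ^ 2) := by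
  refine ContinuousLinearMap.opNorm_le_bound _ (Real.sqrt_nonneg _) fun x => ?_
  rw [EuclideanSpace.norm_eq, EuclideanSpace.norm_eq, ← Real.sqrt_mul (by positivity)]
  refine Real.sqrt_le_sqrt (le_of_eq ?_)
  simp [Fin.sum_univ_two, Matrix.ofLp_toEuclideanCLM, Matrix.mulVec, dotProduct,
    Complex.sq_norm, Complex.normSq_apply]
  ring

/-- For a truncated Gaussian distribution on `[r₀−π, r₀+π]` with width `σ > 0`, the
averaged coin matrix `Ũ = ∫ U_r dν(r)` has operator norm strictly less than `1`. -/
theorem opNorm_gaussian_avg_coin_lt_one (r₀ : ℝ) {σ : ℝ} (hσ : 0 < σ) :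
    opNorm (Matrix.of fun i j =>
        ∫ r in Set.Icc (r₀ - Real.pi) (r₀ + Real.pi),
          ((Real.exp (-(r - r₀) ^ 2 / σ ^ 2) /
            (∫ s in Set.Icc (r₀ - Real.pi) (r₀ + Real.pi),
              Real.exp (-(s - r₀) ^ 2 / σ ^ 2)) : ℝ) : ℂ) * coinMat r i j) < 1 := by
  set N := ∫ s in Set.Icc (r₀ - Real.pi) (r₀ + Real.pi), Real.exp (-(s - r₀) ^ 2 / σ ^ 2) with hN
  set w : ℝ → ℝ := fun r => Real.exp (-(r - r₀) ^ 2 / σ ^ 2) / N with hw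
  have hpi := Real.pi_pos
  have hle : r₀ - Real.pi ≤ r₀ + Real.pi := by linarith
  have hNi : N = ∫ s in (r₀ - Real.pi)..(r₀ + Real.pi), Real.exp (-(s - r₀) ^ 2 / σ ^ 2) := by
    rw [hN, integral_Icc_eq_integral_Ioc, intervalIntegral.integral_of_le hle]
  have hNpos : 0 < N := by
    rw [hNi]
    exact intervalIntegral.intervalIntegral_pos_of_pos
      (Continuous.intervalIntegrable (by fun_prop) _ _) (fun _ => Real.exp_pos _) (by linarith)
  have hone : ∫ r in (r₀ - Real.pi)..(r₀ + Real.pi), w r = 1 := by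
    rw [hw, intervalIntegral.integral_div, ← hNi, div_self hNpos.ne']
  have hlt := sq_integral_cos_add_sq_integral_sin_lt_one (by linarith) (by fun_prop)
    (fun r => div_pos (Real.exp_pos _) hNpos) hone
  simp only [intervalIntegral.integral_of_le hle, ← integral_Icc_eq_integral_Ioc] at hlt
  refine lt_of_le_of_lt (le_of_eq_of_le (congrArg opNorm ?_) (opNorm_reflection_le
    (∫ r in Set.Icc (r₀ - Real.pi) (r₀ + Real.pi), w r * Real.cos r)
    (∫ r in Set.Icc (r₀ - Real.pi) (r₀ + Real.pi), w r * Real.sin r)))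
    ((Real.sqrt_lt' one_pos).2 (by simpa using hlt))
  ext i j
  rw [← integral_complex_ofReal, ← integral_complex_ofReal]
  fin_cases i <;> fin_cases j <;> simp [coinMat, hw, integral_neg]
end
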